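/- arXiv:2601.18126 — 3 statements merged into one kernel-verified Lean document; each statement's English description precedes it below -/
import Mathlib

section
/- For τ ∈ ℍ and z ∈ ℂ with z ∉ ℤ + τℤ (so that θ11(z,τ) ≠ 0 and θ11(z/τ, −1/τ) ≠ 0), define F(z,τ) = exp(−4π²·G₂(τ)·z²) · z · η(τ)³ / θ11(z,τ). Then F is SL₂(ℤ)-invariant in the sense that F(z, τ+1) = F(z,τ) and F(z/τ, −1/τ) = F(z,τ). -/
open Complex Filter

noncomputable section

/-- Jacobi theta function θ00(z,τ) = Σ_{n∈ℤ} exp(πin²τ + 2πinz). -/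
def θ00 (z τ : ℂ) : ℂ :=
  ∑' n : ℤ, Complex.exp ((Real.pi : ℂ) * I * n ^ 2 * τ + 2 * (Real.pi : ℂ) * I * n * z)

/-- Jacobi theta function θ01(z,τ) = Σ_{n∈ℤ} (−1)^n exp(πin²τ + 2πinz). -/
def θ01 (z τ : ℂ) : ℂ :=
  ∑' n : ℤ, (-1 : ℂ) ^ n *
    Complex.exp ((Real.pi : ℂ) * I * n ^ 2 * τ + 2 * (Real.pi : ℂ) * I * n * z)

/-- Jacobi theta function θ10(z,τ) = Σ_{n∈ℤ} exp(πi(n+1/2)²τ + (2n+1)πiz). -/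
def θ10 (z τ : ℂ) : ℂ :=
  ∑' n : ℤ, Complex.exp ((Real.pi : ℂ) * I * (n + 1 / 2) ^ 2 * τ +
    (2 * n + 1) * (Real.pi : ℂ) * I * z)

/-- Jacobi theta function θ11(z,τ) = Σ_{n∈ℤ} (−1)^n exp(πi(n+1/2)²τ + (2n+1)πiz). -/
def θ11 (z τ : ℂ) : ℂ :=
  ∑' n : ℤ, (-1 : ℂ) ^ n * Complex.exp ((Real.pi : ℂ) * I * (n + 1 / 2) ^ 2 * τ +
    (2 * n + 1) * (Real.pi : ℂ) * I * z)

/-- Dedekind eta function η(τ) = q^{1/24} ∏_{n≥1} (1 − qⁿ), q = exp(2πiτ). -/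
def η (τ : ℂ) : ℂ :=
  Complex.exp ((Real.pi : ℂ) * I * τ / 12) *
    ∏' n : ℕ, (1 - Complex.exp (2 * (Real.pi : ℂ) * I * τ) ^ (n + 1))

/-- Weight-two quasimodular Eisenstein series G₂(τ) = 1/24 − Σ_{n≥1} σ₁(n) qⁿ. -/
def G₂ (τ : ℂ) : ℂ :=
  1 / 24 - ∑' n : ℕ, (∑ d ∈ (n + 1).divisors, (d : ℂ)) *
    Complex.exp (2 * (Real.pi : ℂ) * I * τ) ^ (n + 1)

/-- The characteristic series of the Witten genus:
`F(z,τ) = exp(−4π²·G₂(τ)·z²)·z·η(τ)³/θ11(z,τ)`. -/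
def WittenF (z τ : ℂ) : ℂ :=
  Complex.exp (-4 * (Real.pi : ℂ) ^ 2 * G₂ τ * z ^ 2) * z * η τ ^ 3 / θ11 z τ

lemma wf_q_add_one (τ : ℂ) : Complex.exp (2 * (Real.pi : ℂ) * I * (τ + 1)) =
    Complex.exp (2 * (Real.pi : ℂ) * I * τ) := by
  rw [mul_add, mul_one, Complex.exp_add, Complex.exp_two_pi_mul_I, mul_one]

lemma wf_G₂_add_one (τ : ℂ) : G₂ (τ + 1) = G₂ τ := by
  unfold G₂; rw [wf_q_add_one]

lemma wf_η_add_one (τ : ℂ) : η (τ + 1) = Complex.exp (Real.pi * I / 12) * η τ := by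
  unfold η
  rw [wf_q_add_one, ← mul_assoc, ← Complex.exp_add]
  congr 2
  ring

lemma wf_θ11_add_one (z τ : ℂ) : θ11 z (τ + 1) = Complex.exp (Real.pi * I / 4) * θ11 z τ := by
  unfold θ11
  rw [← tsum_mul_left]
  refine tsum_congr fun n => ?_
  obtain ⟨k, hk⟩ := Int.even_mul_succ_self n
  have hk' : (n : ℂ) * (n + 1) = k + k := by exact_mod_cast hk
  have : (Real.pi : ℂ) * I * (n + 1 / 2) ^ 2 * (τ + 1) + (2 * n + 1) * (Real.pi : ℂ) * I * z
      = Real.pi * I / 4 + ((Real.pi : ℂ) * I * (n + 1 / 2) ^ 2 * τ +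
        (2 * n + 1) * (Real.pi : ℂ) * I * z) + k * (2 * Real.pi * I) := by
    linear_combination (Real.pi : ℂ) * I * hk'
  rw [this, Complex.exp_add _ (k * (2 * Real.pi * I)), Complex.exp_int_mul_two_pi_mul_I,
    Complex.exp_add (Real.pi * I / 4)]
  ring

lemma wf_θ11_eq (z τ : ℂ) : θ11 z τ =
    Complex.exp (Real.pi * I * τ / 4 + Real.pi * I * z) * jacobiTheta₂ (z + τ / 2 + 1 / 2) τ := by
  unfold θ11 jacobiTheta₂ jacobiTheta₂_term
  rw [← tsum_mul_left]
  refine tsum_congr fun n => ?_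
  have : (-1 : ℂ) ^ n = Complex.exp (n * (Real.pi * I)) := by
    rw [Complex.exp_int_mul, Complex.exp_pi_mul_I]
  rw [this, ← Complex.exp_add, ← Complex.exp_add]
  congr 1
  ring

lemma wf_θ11_S (z τ : ℂ) (hτ : 0 < τ.im) : θ11 (z / τ) (-1 / τ) =
    -I * (-I * τ) ^ (1 / 2 : ℂ) * Complex.exp (Real.pi * I * z ^ 2 / τ) * θ11 z τ := by
  have h0 : τ ≠ 0 := by rintro rfl; simp at hτ
  have hc : (-I * τ) ^ (1 / 2 : ℂ) ≠ 0 := by simp [Complex.cpow_eq_zero_iff, h0]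
  rw [wf_θ11_eq, wf_θ11_eq]
  have h1 := jacobiTheta₂_functional_equation (z - 1 / 2 + τ / 2) τ
  have h2 := jacobiTheta₂_add_left (z - 1 / 2 + τ / 2) τ
  rw [show z - 1 / 2 + τ / 2 + 1 = z + τ / 2 + 1 / 2 by ring] at h2
  rw [h2, h1, show z / τ + -1 / τ / 2 + 1 / 2 = (z - 1 / 2 + τ / 2) / τ by field_simp; ring]
  have hI : -I = Complex.exp (-(Real.pi / 2 * I)) := by
    rw [Complex.exp_neg, Complex.exp_pi_div_two_mul_I, Complex.inv_I]
  generalize jacobiTheta₂ ((z - 1 / 2 + τ / 2) / τ) (-1 / τ) = J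
  generalize (-I * τ) ^ (1 / 2 : ℂ) = c at *
  have e : Complex.exp (Real.pi * I * (-1 / τ) / 4 + Real.pi * I * (z / τ)) =
      -I * Complex.exp (Real.pi * I * z ^ 2 / τ) *
      Complex.exp (Real.pi * I * τ / 4 + Real.pi * I * z) *
      Complex.exp (-Real.pi * I * (z - 1 / 2 + τ / 2) ^ 2 / τ) := by
    rw [hI, ← Complex.exp_add, ← Complex.exp_add, ← Complex.exp_add]
    congr 1
    field_simp
    ring
  rw [e]
  field_simp

lemma wf_η_eq (τ : ℂ) : η τ = ModularForm.eta τ := by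
  unfold η ModularForm.eta
  simp only [ModularForm.eta_q_eq_pow, Function.Periodic.qParam]
  congr 2
  push_cast
  ring

lemma wf_sqrt (τ : ℂ) (hτ : 0 < τ.im) :
    (-I * τ) ^ (1 / 2 : ℂ) = (Complex.sqrt I)⁻¹ * Complex.sqrt τ := by
  have h0 : τ ≠ 0 := by rintro rfl; simp at hτ
  have hm : arg (-I) + arg τ ∈ Set.Ioc (-Real.pi) Real.pi := by
    have a1 := Complex.arg_nonneg_iff.2 hτ.le
    have a2 := Complex.arg_le_pi τ
    have := Real.pi_pos
    rw [Complex.arg_neg_I]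
    constructor <;> linarith
  rw [Complex.cpow_def_of_ne_zero (by simp [h0]), Complex.log_mul (by simp) h0 hm,
    Complex.sqrt, Complex.sqrt, Complex.cpow_def_of_ne_zero I_ne_zero,
    Complex.cpow_def_of_ne_zero h0, ← Complex.exp_neg, ← Complex.exp_add,
    Complex.log_neg_I, Complex.log_I]
  congr 1
  ring

lemma wf_η_S (τ : ℂ) (hτ : 0 < τ.im) : η (-1 / τ) = (-I * τ) ^ (1 / 2 : ℂ) * η τ := by
  have := ModularForm.eta_comp_eq_csqrt_I_inv (show τ ∈ UpperHalfPlane.upperHalfPlaneSet from hτ)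
  simp only [Function.comp, Pi.smul_apply, Pi.mul_apply, smul_eq_mul] at this
  rw [wf_η_eq, wf_η_eq, this, wf_sqrt τ hτ, mul_assoc]

lemma wf_G₂_eq (τ : UpperHalfPlane) : EisensteinSeries.G2 τ = 8 * Real.pi ^ 2 * G₂ τ := by
  rw [EisensteinSeries.G2_eq_tsum_cexp, riemannZeta_two, G₂,
    tsum_pnat_eq_tsum_succ (f := fun n ↦
      (ArithmeticFunction.sigma 1 n : ℂ) * Complex.exp (2 * Real.pi * I * τ) ^ n)]
  simp only [ArithmeticFunction.sigma_one_apply]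
  push_cast
  ring

lemma wf_G₂_S (τ : ℂ) (hτ : 0 < τ.im) :
    8 * Real.pi ^ 2 * G₂ (-1 / τ) = τ ^ 2 * (8 * Real.pi ^ 2 * G₂ τ) - 2 * Real.pi * I * τ := by
  have h0 : τ ≠ 0 := by rintro rfl; simp at hτ
  have := EisensteinSeries.G2_S_transform ⟨τ, hτ⟩
  rw [wf_G₂_eq, wf_G₂_eq, UpperHalfPlane.modular_S_smul] at this
  have e : (-τ)⁻¹ = -1 / τ := by rw [inv_neg, neg_div, one_div]
  simp only [UpperHalfPlane.coe_mk, e] at this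
  rw [this]
  field_simp
  ring

/-- For `z` not in the lattice `ℤ + τℤ`, the function `F` is `SL₂(ℤ)`-invariant:
`F(z,τ+1) = F(z,τ)` and `F(z/τ,−1/τ) = F(z,τ)`. -/
theorem WittenF_SL2_invariant (z τ : ℂ) (hτ : 0 < τ.im)
    (hz : ∀ m n : ℤ, z ≠ (m : ℂ) + (n : ℂ) * τ) :
    WittenF z (τ + 1) = WittenF z τ ∧ WittenF (z / τ) (-1 / τ) = WittenF z τ := by
  have h0 : τ ≠ 0 := by rintro rfl; simp at hτ
  have hpi : (Real.pi : ℂ) ≠ 0 := by exact_mod_cast Real.pi_ne_zero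
  constructor
  · unfold WittenF
    rw [wf_G₂_add_one, wf_η_add_one, wf_θ11_add_one, mul_pow, ← Complex.exp_nat_mul]
    rw [show ((3 : ℕ) : ℂ) * (Real.pi * I / 12) = Real.pi * I / 4 by push_cast; ring]
    rw [mul_left_comm, mul_div_mul_left _ _ (Complex.exp_ne_zero _)]
  · have hc : (-I * τ) ^ (1 / 2 : ℂ) ≠ 0 := by simp [Complex.cpow_eq_zero_iff, h0]
    have hc2 : ((-I * τ) ^ (1 / 2 : ℂ)) ^ 2 = -I * τ := by
      rw [← Complex.cpow_nat_mul]; norm_num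
    unfold WittenF
    rw [wf_η_S τ hτ, wf_θ11_S z τ hτ]
    have e : Complex.exp (-4 * Real.pi ^ 2 * G₂ (-1 / τ) * (z / τ) ^ 2) =
        Complex.exp (-4 * Real.pi ^ 2 * G₂ τ * z ^ 2) * Complex.exp (Real.pi * I * z ^ 2 / τ) := by
      rw [← Complex.exp_add]
      congr 1
      have := wf_G₂_S τ hτ
      field_simp
      field_simp at this
      linear_combination (-z ^ 2 / 2) * this
    rw [e]
    generalize (-I * τ) ^ (1 / 2 : ℂ) = c at *
    have hE := Complex.exp_ne_zero (Real.pi * I * z ^ 2 / τ)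
    generalize Complex.exp (Real.pi * I * z ^ 2 / τ) = E at *
    generalize Complex.exp (-4 * Real.pi ^ 2 * G₂ τ * z ^ 2) = A
    have hk : A * E * (z / τ) * (c * η τ) ^ 3 = (-I * c * E) * (A * z * η τ ^ 3) := by
      have : c ^ 3 = -I * τ * c := by rw [← hc2]; ring
      rw [mul_pow, this]
      field_simp
    rw [hk, mul_div_mul_left]
    simp [hc, hE]

end
end

section
/- Product expansion of θ10: for all z ∈ ℂ and τ ∈ ℍ, Σ_{n∈ℤ} exp(πi(n+1/2)²τ + (2n+1)πiz) = q^{1/8}·(e^{πiz} + e^{−πiz})·∏_{n=1}^∞ (1 − q^n)(1 + q^n e^{2πiz})(1 + q^n e^{−2πiz}), where q^{1/8} = exp(πiτ/4), and the infinite product converges. -/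
open Complex Filter

noncomputable section

open Topology

def qfac (q : ℂ) (m : ℕ) : ℂ := ∏ k ∈ Finset.range m, (1 - q ^ (k + 1))

def qbin (q : ℂ) : ℕ → ℕ → ℂ
  | _, 0 => 1
  | 0, _ + 1 => 0
  | M + 1, j + 1 => qbin q M (j + 1) + q ^ (M - j) * qbin q M j

lemma qbin_zero_right (q : ℂ) (M : ℕ) : qbin q M 0 = 1 := by
  cases M <;> simp [qbin]

lemma qbin_gt (q : ℂ) : ∀ (M j : ℕ), M < j → qbin q M j = 0 := by
  intro M
  induction M with
  | zero => intro j hj; cases j with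
    | zero => omega
    | succ j => simp [qbin]
  | succ M ih => intro j hj; cases j with
    | zero => omega
    | succ j => simp [qbin, ih (j+1) (by omega), ih j (by omega)]

lemma qfac_succ (q : ℂ) (m : ℕ) : qfac q (m + 1) = qfac q m * (1 - q ^ (m + 1)) := by
  simp [qfac, Finset.prod_range_succ]

lemma qbin_qfac (q : ℂ) (M : ℕ) : ∀ i j : ℕ, i + j = M →
    qbin q M i * qfac q i * qfac q j = qfac q M := by
  induction M with
  | zero =>
    intro i j h
    obtain rfl : i = 0 := by omega
    obtain rfl : j = 0 := by omega
    simp [qfac, qbin]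
  | succ M ih =>
    intro i j h
    cases i with
    | zero =>
      obtain rfl : j = M + 1 := by omega
      rw [qbin_zero_right]; simp [qfac]
    | succ i =>
      have h2 := ih i j (by omega)
      have hMi : M - i = j := by omega
      rw [qbin, hMi]
      cases j with
      | zero =>
        obtain rfl : i = M := by omega
        rw [qbin_gt q i (i+1) (by omega), qfac_succ]
        linear_combination (1 - q ^ (i + 1)) * h2
      | succ j =>
        have h1 := ih (i+1) j (by omega)
        have e : M + 1 = (i + 1) + (j + 1) := by omega
        rw [qfac_succ q M, e, pow_add]
        rw [qfac_succ q i] at *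
        rw [qfac_succ q j] at *
        linear_combination (1 - q ^ (j+1)) * h1 + q^(j+1) * (1 - q^(i+1)) * h2

lemma qbinom_thm (q y : ℂ) (M : ℕ) : ∏ k ∈ Finset.range M, (1 + q ^ k * y) =
    ∑ j ∈ Finset.range (M + 1), qbin q M j * q ^ (j.choose 2) * y ^ j := by
  induction M with
  | zero => simp [qbin]
  | succ M ih =>
    rw [Finset.prod_range_succ, ih, Finset.sum_range_succ' _ (M + 1)]
    have h : ∀ j ∈ Finset.range (M + 1),
        qbin q (M + 1) (j + 1) * q ^ ((j + 1).choose 2) * y ^ (j + 1) =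
        qbin q M (j + 1) * q ^ ((j + 1).choose 2) * y ^ (j + 1) +
        (qbin q M j * q ^ (j.choose 2) * y ^ j) * (q ^ M * y) := by
      intro j hj
      have hj' : j ≤ M := by simpa [Nat.lt_succ_iff] using hj
      obtain ⟨d, rfl⟩ := Nat.exists_eq_add_of_le hj'
      have hc : (j + 1).choose 2 = j + j.choose 2 := by
        rw [Nat.choose_succ_succ' j 1]; simp
      rw [qbin, hc]
      simp only [Nat.add_sub_cancel_left]
      ring
    rw [Finset.sum_congr rfl h, Finset.sum_add_distrib, ← Finset.sum_mul]
    have h2 := Finset.sum_range_succ' (fun j => qbin q M j * q ^ (j.choose 2) * y ^ j) (M + 1)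
    rw [Finset.sum_range_succ, qbin_gt q M (M+1) (by omega)] at h2
    simp only [qbin_zero_right] at *
    linear_combination h2

lemma prod_split (q x : ℂ) (hq : q ≠ 0) (hx : x ≠ 0) (N : ℕ) :
    ∏ k ∈ Finset.range (2 * N), (1 + q ^ k * (x * q / q ^ N)) =
      x ^ N / q ^ (N.choose 2) * (∏ k ∈ Finset.range N, (1 + q ^ (k + 1) * x)) *
        ∏ k ∈ Finset.range N, (1 + q ^ k * x⁻¹) := by
  rw [two_mul, Finset.prod_range_add]
  have h2 : ∏ k ∈ Finset.range N, (1 + q ^ (N + k) * (x * q / q ^ N)) =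
      ∏ k ∈ Finset.range N, (1 + q ^ (k + 1) * x) := by
    refine Finset.prod_congr rfl fun k _ => ?_
    field_simp
    ring
  have h1 : ∏ k ∈ Finset.range N, (1 + q ^ k * (x * q / q ^ N)) =
      ∏ k ∈ Finset.range N, (x / q ^ k * (1 + q ^ k * x⁻¹)) := by
    rw [← Finset.prod_range_reflect]
    refine Finset.prod_congr rfl fun k hk => ?_
    have hk' := Finset.mem_range.1 hk
    obtain ⟨d, rfl⟩ := Nat.exists_eq_add_of_lt hk'
    have : k + d + 1 - 1 - k = d := by omega
    rw [this]
    field_simp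
    ring
  rw [h1, h2, Finset.prod_mul_distrib, Finset.prod_div_distrib, Finset.prod_const,
    Finset.prod_pow_eq_pow_sum, Finset.card_range, Finset.sum_range_id, Nat.choose_two_right]
  ring

lemma finite_triple (q x : ℂ) (hq : q ≠ 0) (hx : x ≠ 0) (N : ℕ) :
    (∏ k ∈ Finset.range N, (1 + q ^ (k + 1) * x)) * ∏ k ∈ Finset.range N, (1 + q ^ k * x⁻¹) =
    ∑ j ∈ Finset.range (2 * N + 1), qbin q (2 * N) j *
      (q ^ (N.choose 2) / x ^ N * q ^ (j.choose 2) * (x * q / q ^ N) ^ j) := by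
  have h := prod_split q x hq hx N
  rw [qbinom_thm] at h
  have : ∀ A B : ℂ, A * B = q ^ (N.choose 2) / x ^ N * (x ^ N / q ^ (N.choose 2) * A * B) := by
    intro A B; field_simp
  rw [this, ← h, Finset.mul_sum]
  refine Finset.sum_congr rfl fun j _ => by ring

lemma term_eq (z τ : ℂ) (N j : ℕ) :
    Complex.exp ((Real.pi : ℂ) * I * τ / 4) * Complex.exp ((Real.pi : ℂ) * I * z) *
    (Complex.exp (2 * (Real.pi : ℂ) * I * τ) ^ (N.choose 2) /
      Complex.exp (2 * (Real.pi : ℂ) * I * z) ^ N *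
      Complex.exp (2 * (Real.pi : ℂ) * I * τ) ^ (j.choose 2) *
      (Complex.exp (2 * (Real.pi : ℂ) * I * z) * Complex.exp (2 * (Real.pi : ℂ) * I * τ) /
        Complex.exp (2 * (Real.pi : ℂ) * I * τ) ^ N) ^ j) =
    Complex.exp ((Real.pi : ℂ) * I * (((j : ℤ) - (N : ℤ) : ℤ) + 1 / 2) ^ 2 * τ +
        (2 * ((j : ℤ) - (N : ℤ) : ℤ) + 1) * (Real.pi : ℂ) * I * z) := by
  simp only [← Complex.exp_nat_mul, ← Complex.exp_add, ← Complex.exp_sub]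
  congr 1
  rw [Nat.cast_choose_two, Nat.cast_choose_two]
  push_cast
  ring

lemma T_summable (z τ : ℂ) (hτ : 0 < τ.im) :
    Summable (fun n : ℤ => Complex.exp ((Real.pi : ℂ) * I * (n + 1 / 2) ^ 2 * τ +
        (2 * n + 1) * (Real.pi : ℂ) * I * z)) := by
  have h := ((summable_jacobiTheta₂_term_iff (z + τ / 2) τ).2 hτ).mul_left
    (Complex.exp ((Real.pi : ℂ) * I * τ / 4 + (Real.pi : ℂ) * I * z))
  refine h.congr fun n => ?_
  rw [jacobiTheta₂_term, ← Complex.exp_add]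
  congr 1
  ring

lemma norm_pow_summable (q c : ℂ) (hq : ‖q‖ < 1) : Summable (fun n : ℕ => ‖q ^ (n + 1) * c‖) := by
  have := ((summable_geometric_of_lt_one (norm_nonneg q) hq).mul_left ‖q‖).mul_right ‖c‖
  refine this.congr fun n => ?_
  rw [norm_mul, norm_pow]; ring

lemma mult_one (q c : ℂ) (hq : ‖q‖ < 1) : Multipliable (fun n : ℕ => 1 + q ^ (n + 1) * c) :=
  multipliable_one_add_of_summable (norm_pow_summable q c hq)

lemma one_sub_ne (q : ℂ) (hq : ‖q‖ < 1) (n : ℕ) : 1 - q ^ (n + 1) ≠ 0 := by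
  intro h
  have h1 : ‖q ^ (n+1)‖ = 1 := by rw [← sub_eq_zero.1 h]; simp
  rw [norm_pow] at h1
  exact absurd h1 (pow_lt_one₀ (norm_nonneg _) hq (by omega)).ne

lemma qfac_ne (q : ℂ) (hq : ‖q‖ < 1) (m : ℕ) : qfac q m ≠ 0 :=
  Finset.prod_ne_zero_iff.2 fun k _ => one_sub_ne q hq k

lemma qfac_lim (q : ℂ) (hq : ‖q‖ < 1) : ∃ L : ℂ, L ≠ 0 ∧ Tendsto (qfac q) atTop (𝓝 L) := by
  refine ⟨∏' n : ℕ, (1 + q ^ (n + 1) * (-1)), ?_, ?_⟩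
  · exact tprod_one_add_ne_zero_of_summable
      (fun i => by simpa [← sub_eq_add_neg] using one_sub_ne q hq i) (norm_pow_summable q _ hq)
  · have := (mult_one q (-1) hq).tendsto_prod_tprod_nat
    refine this.congr fun n => ?_
    simp [qfac, sub_eq_add_neg]

lemma bdd_of_lim (f : ℕ → ℂ) (L : ℂ) (h : Tendsto f atTop (𝓝 L)) : ∃ C : ℝ, ∀ n, ‖f n‖ ≤ C := by
  obtain ⟨C, hC⟩ := (Metric.isBounded_range_of_tendsto f h).exists_norm_le
  exact ⟨C, fun n => hC _ ⟨n, rfl⟩⟩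

/-- Normalised coefficient. -/
def coef (q : ℂ) (N : ℕ) (n : ℤ) : ℂ :=
  if -(N : ℤ) ≤ n ∧ n ≤ N then qfac q N * qbin q (2 * N) (n + N).toNat else 0

lemma coef_eq (q : ℂ) (hq : ‖q‖ < 1) (N : ℕ) (n : ℤ) (h : -(N : ℤ) ≤ n ∧ n ≤ N) :
    coef q N n = qfac q N * qfac q (2 * N) * (qfac q (n + N).toNat)⁻¹ *
      (qfac q (N - n).toNat)⁻¹ := by
  rw [coef, if_pos h, ← qbin_qfac q (2 * N) (n + N).toNat (N - n).toNat (by omega)]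
  have h1 := qfac_ne q hq (n + N).toNat
  have h2 := qfac_ne q hq (N - n).toNat
  field_simp

lemma coef_bdd (q : ℂ) (hq : ‖q‖ < 1) : ∃ K : ℝ, ∀ N n, ‖coef q N n‖ ≤ K := by
  obtain ⟨L, hL, h⟩ := qfac_lim q hq
  obtain ⟨C, hC⟩ := bdd_of_lim _ _ h
  obtain ⟨D, hD⟩ := bdd_of_lim _ _ (h.inv₀ hL)
  have hC0 : 0 ≤ C := (norm_nonneg _).trans (hC 0)
  have hD0 : 0 ≤ D := (norm_nonneg _).trans (hD 0)
  refine ⟨C * C * D * D, fun N n => ?_⟩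
  by_cases hn : -(N : ℤ) ≤ n ∧ n ≤ N
  · rw [coef_eq q hq N n hn, norm_mul, norm_mul, norm_mul]
    gcongr
    · exact hC _
    · exact hC _
    · exact hD _
    · exact hD _
  · rw [coef, if_neg hn, norm_zero]; positivity

lemma coef_lim (q : ℂ) (hq : ‖q‖ < 1) (n : ℤ) :
    Tendsto (fun N => coef q N n) atTop (𝓝 1) := by
  obtain ⟨L, hL, h⟩ := qfac_lim q hq
  have t1 : Tendsto (fun N : ℕ => 2 * N) atTop atTop :=
    tendsto_atTop_mono (f := fun N : ℕ => N) (fun N => by omega) tendsto_id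
  have t2 : Tendsto (fun N : ℕ => (n + N).toNat) atTop atTop :=
    tendsto_atTop_mono (f := fun N : ℕ => N - n.natAbs) (fun N => by omega)
      (tendsto_sub_atTop_nat _)
  have t3 : Tendsto (fun N : ℕ => (N - n).toNat) atTop atTop :=
    tendsto_atTop_mono (f := fun N : ℕ => N - n.natAbs) (fun N => by omega)
      (tendsto_sub_atTop_nat _)
  have H := ((h.mul (h.comp t1)).mul ((h.comp t2).inv₀ hL)).mul ((h.comp t3).inv₀ hL)
  have e : L * L * L⁻¹ * L⁻¹ = 1 := by field_simp
  rw [e] at H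
  refine H.congr' ?_
  filter_upwards [eventually_ge_atTop n.natAbs] with N hN
  rw [coef_eq q hq N n (by omega)]
  rfl

lemma coef_sum (q : ℂ) (T : ℤ → ℂ) (N : ℕ) :
    ∑' n : ℤ, coef q N n * T n =
      qfac q N * ∑ j ∈ Finset.range (2 * N + 1), qbin q (2 * N) j * T ((j : ℤ) - (N : ℤ)) := by
  rw [tsum_eq_sum (s := (Finset.range (2 * N + 1)).image (fun j : ℕ => (j : ℤ) - (N : ℤ))),
    Finset.sum_image, Finset.mul_sum]
  · refine Finset.sum_congr rfl fun j hj => ?_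
    have := Finset.mem_range.1 hj
    rw [coef, if_pos (by omega), sub_add_cancel, Int.toNat_natCast, mul_assoc]
  · intro a _ b _ hab
    simp only at hab
    omega
  · intro n hn
    rw [coef, if_neg, zero_mul]
    intro h
    apply hn
    rw [Finset.mem_image]
    exact ⟨(n + N).toNat, Finset.mem_range.2 (by omega), by omega⟩

/-- Product expansion of θ10:
`Σ_{n∈ℤ} exp(πi(n+1/2)²τ + (2n+1)πiz)
  = q^{1/8}(e^{πiz} + e^{−πiz})·∏_{n≥1}(1−qⁿ)(1+qⁿe^{2πiz})(1+qⁿe^{−2πiz})`,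
with the infinite product convergent. -/
theorem θ10_product_expansion (z τ : ℂ) (hτ : 0 < τ.im) :
    Multipliable (fun n : ℕ =>
      (1 - Complex.exp (2 * (Real.pi : ℂ) * I * τ) ^ (n + 1)) *
      (1 + Complex.exp (2 * (Real.pi : ℂ) * I * τ) ^ (n + 1) *
          Complex.exp (2 * (Real.pi : ℂ) * I * z)) *
      (1 + Complex.exp (2 * (Real.pi : ℂ) * I * τ) ^ (n + 1) *
          Complex.exp (-(2 : ℂ) * (Real.pi : ℂ) * I * z))) ∧
    (∑' n : ℤ, Complex.exp ((Real.pi : ℂ) * I * (n + 1 / 2) ^ 2 * τ +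
        (2 * n + 1) * (Real.pi : ℂ) * I * z))
      = Complex.exp ((Real.pi : ℂ) * I * τ / 4) *
        (Complex.exp ((Real.pi : ℂ) * I * z) + Complex.exp (-(Real.pi : ℂ) * I * z)) *
        ∏' n : ℕ,
          (1 - Complex.exp (2 * (Real.pi : ℂ) * I * τ) ^ (n + 1)) *
          (1 + Complex.exp (2 * (Real.pi : ℂ) * I * τ) ^ (n + 1) *
              Complex.exp (2 * (Real.pi : ℂ) * I * z)) *
          (1 + Complex.exp (2 * (Real.pi : ℂ) * I * τ) ^ (n + 1) *
              Complex.exp (-(2 : ℂ) * (Real.pi : ℂ) * I * z)) := by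
  have hqn : ‖Complex.exp (2 * (Real.pi : ℂ) * I * τ)‖ < 1 := by
    rw [Complex.norm_exp, Real.exp_lt_one_iff]
    have : (2 * (Real.pi : ℂ) * I * τ).re = -(2 * Real.pi * τ.im) := by simp
    rw [this]
    have := Real.pi_pos
    have : 0 < 2 * Real.pi * τ.im := by positivity
    linarith
  have hxi : Complex.exp (-(2 : ℂ) * (Real.pi : ℂ) * I * z) =
      (Complex.exp (2 * (Real.pi : ℂ) * I * z))⁻¹ := by
    rw [← Complex.exp_neg]; congr 1; ring
  have hpre : Complex.exp ((Real.pi : ℂ) * I * z) + Complex.exp (-(Real.pi : ℂ) * I * z) =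
      Complex.exp ((Real.pi : ℂ) * I * z) * (1 + (Complex.exp (2 * (Real.pi : ℂ) * I * z))⁻¹) := by
    rw [← Complex.exp_neg, mul_add, mul_one, ← Complex.exp_add]; congr 2; ring
  have hterm := term_eq z τ
  have hT := T_summable z τ hτ
  rw [hxi, hpre]
  have hq0 := Complex.exp_ne_zero (2 * (Real.pi : ℂ) * I * τ)
  have hx0 := Complex.exp_ne_zero (2 * (Real.pi : ℂ) * I * z)
  generalize Complex.exp (2 * (Real.pi : ℂ) * I * τ) = q at *
  generalize Complex.exp (2 * (Real.pi : ℂ) * I * z) = x at *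
  generalize hTd : (fun n : ℤ => Complex.exp ((Real.pi : ℂ) * I * (n + 1 / 2) ^ 2 * τ +
        (2 * n + 1) * (Real.pi : ℂ) * I * z)) = T at *
  have hterm' : ∀ N j : ℕ, Complex.exp ((Real.pi : ℂ) * I * τ / 4) *
      Complex.exp ((Real.pi : ℂ) * I * z) * (q ^ (N.choose 2) / x ^ N * q ^ (j.choose 2) *
      (x * q / q ^ N) ^ j) = T ((j : ℤ) - (N : ℤ)) := fun N j => by
    rw [← hTd]; exact hterm N j
  clear hterm
  generalize Complex.exp ((Real.pi : ℂ) * I * τ / 4) = A at *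
  generalize Complex.exp ((Real.pi : ℂ) * I * z) = B at *
  have hm : Multipliable (fun n : ℕ => (1 - q ^ (n + 1)) * (1 + q ^ (n + 1) * x) *
      (1 + q ^ (n + 1) * x⁻¹)) := by
    have := ((mult_one q (-1) hqn).mul (mult_one q x hqn)).mul (mult_one q x⁻¹ hqn)
    simpa [← sub_eq_add_neg] using this
  refine ⟨hm, ?_⟩
  obtain ⟨K, hK⟩ := coef_bdd q hqn
  have lim1 : Tendsto (fun N => ∑' n, coef q N n * T n) atTop (𝓝 (∑' n, T n)) := by
    refine tendsto_tsum_of_dominated_convergence (bound := fun n => K * ‖T n‖)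
      (hT.norm.mul_left K) (fun n => ?_) (Eventually.of_forall fun N n => ?_)
    · simpa using (coef_lim q hqn n).mul_const (T n)
    · rw [norm_mul]
      exact mul_le_mul_of_nonneg_right (hK N n) (norm_nonneg _)
  have hqN : Tendsto (fun N : ℕ => 1 + q ^ N * x⁻¹) atTop (𝓝 1) := by
    simpa using ((tendsto_pow_atTop_nhds_zero_of_norm_lt_one hqn).mul_const x⁻¹).const_add 1
  have lim2 := lim1.mul hqN
  rw [mul_one] at lim2
  have lim3 := hm.tendsto_prod_tprod_nat.const_mul (A * (B * (1 + x⁻¹)))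
  refine tendsto_nhds_unique lim2 (lim3.congr fun N => ?_)
  have e1 : ∑ j ∈ Finset.range (2 * N + 1), qbin q (2 * N) j * T ((j : ℤ) - (N : ℤ)) =
      A * B * ((∏ k ∈ Finset.range N, (1 + q ^ (k + 1) * x)) *
        ∏ k ∈ Finset.range N, (1 + q ^ k * x⁻¹)) := by
    rw [finite_triple q x hq0 hx0, Finset.mul_sum]
    refine Finset.sum_congr rfl fun j _ => ?_
    rw [← hterm']; ring
  rw [coef_sum, e1, Finset.prod_mul_distrib, Finset.prod_mul_distrib]
  have e2 := Finset.prod_range_succ (fun k => 1 + q ^ k * x⁻¹) N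
  rw [Finset.prod_range_succ'] at e2
  simp only [pow_zero, one_mul] at e2
  rw [qfac]
  linear_combination A * B * (∏ k ∈ Finset.range N, (1 - q ^ (k + 1))) *
    (∏ k ∈ Finset.range N, (1 + q ^ (k + 1) * x)) * e2

end
end

section
/- Product expansion of θ01: for all z ∈ ℂ and τ ∈ ℍ, Σ_{n∈ℤ} (−1)^n exp(πin²τ + 2πinz) = ∏_{n=1}^∞ (1 − q^n)(1 − q^{n−1/2} e^{2πiz})(1 − q^{n−1/2} e^{−2πiz}), where q^{n−1/2} = exp(2πi(n−1/2)τ), and the infinite product converges. -/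
open Complex Filter

noncomputable section

/-- Finite `q`-Pochhammer product. -/
def qP (Q : ℂ) (n : ℕ) : ℂ := ∏ i ∈ Finset.range n, (1 - Q ^ (i + 1))

/-- Reciprocal of the finite `q`-Pochhammer product, extended by zero. -/
def qR (Q : ℂ) (n : ℤ) : ℂ := if n < 0 then 0 else (qP Q n.toNat)⁻¹

/-- The general term of the theta series. -/
def tT (p w : ℂ) (j : ℤ) : ℂ := (-1 : ℂ) ^ j * p ^ (j ^ 2) * w ^ j

lemma one_sub_pow_ne {Q : ℂ} (hQ : ‖Q‖ < 1) (n : ℕ) : 1 - Q ^ (n + 1) ≠ 0 := by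
  intro h
  have h1 : ‖Q ^ (n + 1)‖ < 1 := by
    rw [norm_pow]
    exact pow_lt_one₀ (norm_nonneg _) hQ (Nat.succ_ne_zero n)
  rw [← sub_eq_zero.mp h] at h1
  simp at h1

lemma qP_ne {Q : ℂ} (hQ : ‖Q‖ < 1) (n : ℕ) : qP Q n ≠ 0 :=
  Finset.prod_ne_zero_iff.mpr fun i _ => one_sub_pow_ne hQ i

lemma qP_succ (Q : ℂ) (n : ℕ) : qP Q (n + 1) = qP Q n * (1 - Q ^ (n + 1)) := by
  simp [qP, Finset.prod_range_succ]

lemma qR_rec {Q : ℂ} (hQ : ‖Q‖ < 1) (n : ℤ) : qR Q (n - 1) = (1 - Q ^ n) * qR Q n := by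
  rcases lt_trichotomy n 0 with h | h | h
  · simp [qR, h, show n - 1 < 0 by omega]
  · subst h; simp [qR]
  · obtain ⟨k, rfl⟩ : ∃ k : ℕ, n = k + 1 := ⟨(n - 1).toNat, by omega⟩
    have h1 : ¬ ((k : ℤ) + 1 < 0) := by omega
    have h2 : ¬ ((k : ℤ) < 0) := by omega
    have h3 : ((k : ℤ) + 1).toNat = k + 1 := by omega
    have e : Q ^ ((k : ℤ) + 1) = Q ^ (k + 1) := by
      rw [← zpow_natCast]; push_cast; rfl
    simp only [add_sub_cancel_right, qR, h1, h2, if_false, h3, Int.toNat_natCast, qP_succ, e]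
    have := one_sub_pow_ne hQ k
    have := qP_ne hQ k
    field_simp

lemma tT_succ {p w : ℂ} (hp : p ≠ 0) (hw : w ≠ 0) (j : ℤ) :
    w⁻¹ * tT p w (j + 1) = - (p ^ (2 * j + 1) * tT p w j) := by
  have e : p ^ ((j + 1) ^ 2) = p ^ (2 * j + 1) * p ^ (j ^ 2) := by
    rw [← zpow_add₀ hp]; congr 1; ring
  unfold tT
  rw [e, zpow_add_one₀ hw, zpow_add_one₀ (by norm_num : (-1 : ℂ) ≠ 0)]
  field_simp

lemma tT_pred {p w : ℂ} (hp : p ≠ 0) (hw : w ≠ 0) (j : ℤ) :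
    w * tT p w (j - 1) = - (p ^ (1 - 2 * j) * tT p w j) := by
  have e : p ^ ((j - 1) ^ 2) = p ^ (1 - 2 * j) * p ^ (j ^ 2) := by
    rw [← zpow_add₀ hp]; congr 1; ring
  unfold tT
  rw [e, zpow_sub_one₀ hw, zpow_sub_one₀ (by norm_num : (-1 : ℂ) ≠ 0)]
  field_simp

lemma finite_jtp {p w : ℂ} (hp : p ≠ 0) (hw : w ≠ 0) (hQ : ‖p ^ 2‖ < 1) (m : ℕ) :
    HasSum (fun j : ℤ => qP (p ^ 2) (2 * m) * qR (p ^ 2) (m - j) * qR (p ^ 2) (m + j) * tT p w j)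
      (∏ k ∈ Finset.range m, ((1 - p ^ (2 * k + 1) * w) * (1 - p ^ (2 * k + 1) * w⁻¹))) := by
  induction m with
  | zero =>
    have := hasSum_single (f := fun j : ℤ => qP (p ^ 2) (2 * 0) * qR (p ^ 2) ((0 : ℕ) - j) *
      qR (p ^ 2) ((0 : ℕ) + j) * tT p w j) 0 (by
        intro j hj
        rcases lt_or_gt_of_ne hj with h | h
        · simp [qR, h]
        · simp [qR, h])
    simpa [qP, qR, tT] using this
  | succ m ih =>
    rw [Finset.prod_range_succ]
    have h1 := (Equiv.subRight (1 : ℤ)).hasSum_iff.mpr ih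
    have h2 := (Equiv.addRight (1 : ℤ)).hasSum_iff.mpr ih
    have h3 := ((ih.mul_left (1 + p ^ (4 * m + 2))).sub (h1.mul_left (p ^ (2 * m + 1) * w))).sub
      (h2.mul_left (p ^ (2 * m + 1) * w⁻¹))
    convert h3 using 1
    · rfl
    · ext j
      simp only [Function.comp, Equiv.coe_addRight, Equiv.subRight_apply]
      set Q := p ^ 2 with hQd
      have hQ0 : Q ≠ 0 := pow_ne_zero 2 hp
      have a1 := qR_rec hQ ((m : ℤ) + 1 - j)
      have a2 := qR_rec hQ ((m : ℤ) - j)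
      have b1 := qR_rec hQ ((m : ℤ) + 1 + j)
      have b2 := qR_rec hQ ((m : ℤ) + j)
      have e1 : (m : ℤ) + 1 - j - 1 = m - j := by ring
      have e2 : (m : ℤ) + 1 + j - 1 = m + j := by ring
      rw [e1] at a1
      rw [e2] at b1
      rw [a1] at a2
      rw [b1] at b2
      have c1 : (m : ℤ) - (j - 1) = m + 1 - j := by ring
      have c2 : (m : ℤ) + (j - 1) = m + j - 1 := by ring
      have c3 : (m : ℤ) - (j + 1) = m - j - 1 := by ring
      have c4 : (m : ℤ) + (j + 1) = m + 1 + j := by ring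
      have c5 : 2 * (m + 1) = 2 * m + 1 + 1 := by ring
      have hu : Q ^ ((m : ℤ) + 1 - j) = p ^ (2 * m + 1) * p ^ (1 - 2 * j) := by
        rw [hQd, ← zpow_natCast, ← zpow_natCast, ← zpow_mul, ← zpow_add₀ hp]
        congr 1; push_cast; ring
      have hv : Q ^ ((m : ℤ) + 1 + j) = p ^ (2 * m + 1) * p ^ (2 * j + 1) := by
        rw [hQd, ← zpow_natCast, ← zpow_natCast, ← zpow_mul, ← zpow_add₀ hp]
        congr 1; push_cast; ring
      have hu' : Q ^ ((m : ℤ) - j) * Q = Q ^ ((m : ℤ) + 1 - j) := by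
        rw [← zpow_add_one₀ hQ0]; congr 1; ring
      have hv' : Q ^ ((m : ℤ) + j) * Q = Q ^ ((m : ℤ) + 1 + j) := by
        rw [← zpow_add_one₀ hQ0]; congr 1; ring
      have hs : Q ^ (2 * m + 1) * Q = Q ^ ((m : ℤ) + 1 - j) * Q ^ ((m : ℤ) + 1 + j) := by
        rw [← zpow_add₀ hQ0, ← pow_succ, ← zpow_natCast]; congr 1; push_cast; ring
      have hs' : p ^ (4 * m + 2) = Q ^ (2 * m + 1) := by
        rw [hQd, ← pow_mul]; congr 1; ring
      have t1 := tT_pred hp hw j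
      have t2 := tT_succ hp hw j
      push_cast
      rw [c1, c2, c3, c4, c5, qP_succ, qP_succ, a2, b2, a1, b1, hs']
      generalize qR Q ((m : ℤ) + 1 - j) = X
      generalize qR Q ((m : ℤ) + 1 + j) = Y
      generalize qP Q (2 * m) = A
      have g1 : p ^ (2 * m + 1) * w * tT p w (j - 1) = - (Q ^ ((m : ℤ) + 1 - j) * tT p w j) := by
        rw [hu]; linear_combination p ^ (2 * m + 1) * t1
      have g2 : p ^ (2 * m + 1) * w⁻¹ * tT p w (j + 1)
          = - (Q ^ ((m : ℤ) + 1 + j) * tT p w j) := by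
        rw [hv]; linear_combination p ^ (2 * m + 1) * t2
      generalize tT p w (j - 1) = T1 at *
      generalize tT p w (j + 1) = T2 at *
      generalize tT p w j = T at *
      have d1 : Q ^ ((m : ℤ) + 1 - j) * Q ^ ((m : ℤ) + j) = Q ^ (2 * m + 1) := by
        rw [← zpow_add₀ hQ0, ← zpow_natCast]; congr 1; push_cast; ring
      have d2 : Q ^ ((m : ℤ) + 1 + j) * Q ^ ((m : ℤ) - j) = Q ^ (2 * m + 1) := by
        rw [← zpow_add₀ hQ0, ← zpow_natCast]; congr 1; push_cast; ring
      have d3 : Q ^ (2 * m + 1 + 1) = Q ^ ((m : ℤ) + 1 - j) * Q ^ ((m : ℤ) + 1 + j) := by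
        rw [pow_succ, hs]
      rw [d3]
      clear hu hv hu' hv' hs hs' a1 a2 b1 b2 d3 t1 t2 ih h1 h2 h3
      generalize Q ^ ((m : ℤ) + 1 - j) = u at *
      generalize Q ^ ((m : ℤ) + 1 + j) = v at *
      generalize Q ^ ((m : ℤ) - j) = u' at *
      generalize Q ^ ((m : ℤ) + j) = v' at *
      generalize Q ^ (2 * m + 1) = s at *
      generalize p ^ (2 * m + 1) = r at *
      linear_combination (A * X * ((1 - v') * ((1 - v) * Y))) * g1
        + (A * ((1 - u') * ((1 - u) * X)) * Y) * g2
        + A * X * Y * T * (1 - v) * d1 + A * X * Y * T * (1 - u) * d2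
    · generalize ∏ k ∈ Finset.range m, ((1 - p ^ (2 * k + 1) * w) * (1 - p ^ (2 * k + 1) * w⁻¹)) = P
      have hww : w * w⁻¹ = 1 := mul_inv_cancel₀ hw
      linear_combination P * p ^ (4 * m + 2) * hww

lemma qP_tendsto {Q : ℂ} (hQ : ‖Q‖ < 1) :
    ∃ L : ℂ, L ≠ 0 ∧ Tendsto (qP Q) atTop (nhds L) := by
  have hs : Summable fun n : ℕ => ‖-Q ^ (n + 1)‖ := by
    simpa using (summable_nat_add_iff 1).mpr (summable_geometric_of_lt_one (norm_nonneg _) hQ)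
  have hm := multipliable_one_add_of_summable hs
  refine ⟨_, tprod_one_add_ne_zero_of_summable (fun i => ?_) hs, ?_⟩
  · simpa [sub_eq_add_neg] using one_sub_pow_ne hQ i
  · simpa [sub_eq_add_neg, qP] using! hm.tendsto_prod_tprod_nat

lemma jtp_tendsto {p w : ℂ} (hp : p ≠ 0) (hw : w ≠ 0) (hQ : ‖p ^ 2‖ < 1)
    (hsum : Summable (tT p w)) :
    Tendsto (fun m : ℕ => ∏ k ∈ Finset.range m, ((1 - (p ^ 2) ^ (k + 1)) *
      (1 - p ^ (2 * k + 1) * w) * (1 - p ^ (2 * k + 1) * w⁻¹))) atTop (nhds (∑' j, tT p w j)) := by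
  obtain ⟨L, hL, hT⟩ := qP_tendsto hQ
  have hTi : Tendsto (fun n => (qP (p ^ 2) n)⁻¹) atTop (nhds L⁻¹) := hT.inv₀ hL
  obtain ⟨B, hB⟩ := (Metric.isBounded_range_of_tendsto _ hT).exists_norm_le
  obtain ⟨b, hb⟩ := (Metric.isBounded_range_of_tendsto _ hTi).exists_norm_le
  have hB' : ∀ n, ‖qP (p ^ 2) n‖ ≤ B := fun n => hB _ ⟨n, rfl⟩
  have hb' : ∀ n, ‖(qP (p ^ 2) n)⁻¹‖ ≤ b := fun n => hb _ ⟨n, rfl⟩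
  have hB0 : 0 ≤ B := (norm_nonneg _).trans (hB' 0)
  have hb0 : 0 ≤ b := (norm_nonneg _).trans (hb' 0)
  have hR : ∀ n, ‖qR (p ^ 2) n‖ ≤ b := by
    intro n
    unfold qR
    split_ifs
    · simpa using hb0
    · exact hb' _
  have hRT : ∀ f : ℕ → ℤ, Tendsto f atTop atTop →
      Tendsto (fun m => qR (p ^ 2) (f m)) atTop (nhds L⁻¹) := by
    intro f hf
    have h1 : Tendsto (fun m => (f m).toNat) atTop atTop := by
      rw [tendsto_atTop] at hf ⊢
      intro N
      filter_upwards [hf N] with m hm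
      omega
    refine (hTi.comp h1).congr' ?_
    filter_upwards [hf.eventually_ge_atTop 0] with m hm
    simp [qR, not_lt.mpr hm]
  have key := tendsto_tsum_of_dominated_convergence (𝓕 := atTop)
    (f := fun (m : ℕ) (j : ℤ) => qP (p ^ 2) m * (qP (p ^ 2) (2 * m) * qR (p ^ 2) (m - j) *
      qR (p ^ 2) (m + j) * tT p w j)) (g := tT p w)
    (bound := fun j => B * (B * b * b * ‖tT p w j‖)) ((hsum.norm.mul_left _).mul_left _)
    (by
      intro j
      have i1 : Tendsto (fun m : ℕ => (m : ℤ) - j) atTop atTop :=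
        tendsto_atTop_add_const_right _ (-j) tendsto_natCast_atTop_atTop
      have i2 : Tendsto (fun m : ℕ => (m : ℤ) + j) atTop atTop :=
        tendsto_atTop_add_const_right _ j tendsto_natCast_atTop_atTop
      have i3 : Tendsto (fun m : ℕ => 2 * m) atTop atTop :=
        tendsto_id.const_mul_atTop' (by norm_num)
      have := hT.mul ((((hT.comp i3).mul (hRT _ i1)).mul (hRT _ i2)).mul_const (tT p w j))
      have e : L * (L * L⁻¹ * L⁻¹ * tT p w j) = tT p w j := by field_simp
      rw [e] at this
      exact this)
    (Eventually.of_forall fun m j => by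
      simp only [norm_mul]
      gcongr
      · exact hB' _
      · exact hB' _
      · exact hR _
      · exact hR _)
  refine key.congr fun m => ?_
  rw [((finite_jtp hp hw hQ m).mul_left _).tsum_eq, qP, ← Finset.prod_mul_distrib]
  exact Finset.prod_congr rfl fun k _ => by ring

/-- Product expansion of θ01:
`Σ_{n∈ℤ}(−1)ⁿ exp(πin²τ + 2πinz)
  = ∏_{n≥1}(1−qⁿ)(1−q^{n−1/2}e^{2πiz})(1−q^{n−1/2}e^{−2πiz})`,
where `q^{n−1/2} = exp(2πi(n−1/2)τ)`, with the infinite product convergent. -/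
theorem θ01_product_expansion (z τ : ℂ) (hτ : 0 < τ.im) :
    Multipliable (fun n : ℕ =>
      (1 - Complex.exp (2 * (Real.pi : ℂ) * I * τ) ^ (n + 1)) *
      (1 - Complex.exp (2 * (Real.pi : ℂ) * I * ((n : ℂ) + 1 / 2) * τ) *
          Complex.exp (2 * (Real.pi : ℂ) * I * z)) *
      (1 - Complex.exp (2 * (Real.pi : ℂ) * I * ((n : ℂ) + 1 / 2) * τ) *
          Complex.exp (-(2 : ℂ) * (Real.pi : ℂ) * I * z))) ∧
    (∑' n : ℤ, (-1 : ℂ) ^ n *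
        Complex.exp ((Real.pi : ℂ) * I * n ^ 2 * τ + 2 * (Real.pi : ℂ) * I * n * z))
      = ∏' n : ℕ,
          (1 - Complex.exp (2 * (Real.pi : ℂ) * I * τ) ^ (n + 1)) *
          (1 - Complex.exp (2 * (Real.pi : ℂ) * I * ((n : ℂ) + 1 / 2) * τ) *
              Complex.exp (2 * (Real.pi : ℂ) * I * z)) *
          (1 - Complex.exp (2 * (Real.pi : ℂ) * I * ((n : ℂ) + 1 / 2) * τ) *
              Complex.exp (-(2 : ℂ) * (Real.pi : ℂ) * I * z)) := by
  set p : ℂ := Complex.exp ((Real.pi : ℂ) * I * τ) with hpd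
  set w : ℂ := Complex.exp (2 * (Real.pi : ℂ) * I * z) with hwd
  have hp : p ≠ 0 := Complex.exp_ne_zero _
  have hw : w ≠ 0 := Complex.exp_ne_zero _
  have e1 : Complex.exp (2 * (Real.pi : ℂ) * I * τ) = p ^ 2 := by
    rw [hpd, ← Complex.exp_nat_mul]; congr 1; push_cast; ring
  have e2 : ∀ n : ℕ, Complex.exp (2 * (Real.pi : ℂ) * I * ((n : ℂ) + 1 / 2) * τ)
      = p ^ (2 * n + 1) := by
    intro n
    rw [hpd, ← Complex.exp_nat_mul]; congr 1; push_cast; ring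
  have e3 : Complex.exp (-(2 : ℂ) * (Real.pi : ℂ) * I * z) = w⁻¹ := by
    rw [hwd, ← Complex.exp_neg]; congr 1; ring
  have e4 : ∀ n : ℤ, (-1 : ℂ) ^ n *
        Complex.exp ((Real.pi : ℂ) * I * n ^ 2 * τ + 2 * (Real.pi : ℂ) * I * n * z)
      = tT p w n := by
    intro n
    rw [tT, hpd, hwd, ← Complex.exp_int_mul, ← Complex.exp_int_mul,
      mul_assoc ((-1 : ℂ) ^ n), ← Complex.exp_add]
    congr 2; push_cast; ring
  have hp1 : ‖p‖ < 1 := by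
    rw [hpd, Complex.norm_exp, Real.exp_lt_one_iff]
    have : ((Real.pi : ℂ) * I * τ).re = -(Real.pi * τ.im) := by simp
    rw [this]
    have := mul_pos Real.pi_pos hτ
    linarith
  have hQ : ‖p ^ 2‖ < 1 := by
    rw [norm_pow]
    exact pow_lt_one₀ (norm_nonneg _) hp1 two_ne_zero
  have hsum : Summable (tT p w) := by
    rw [← summable_norm_iff]
    refine ((hasSum_jacobiTheta₂_term z hτ).summable.norm).congr fun n => ?_
    rw [← e4, jacobiTheta₂_term]
    simp [add_comm]
  simp only [e1, e2, e3, e4]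
  have hm1 : Multipliable fun n : ℕ => 1 - (p ^ 2) ^ (n + 1) := by
    have hs : Summable fun n : ℕ => ‖-(p ^ 2) ^ (n + 1)‖ := by
      simpa only [norm_neg, norm_pow] using (summable_nat_add_iff 1).mpr
        (summable_geometric_of_lt_one (norm_nonneg _) hQ)
    simpa only [sub_eq_add_neg] using multipliable_one_add_of_summable hs
  have hm2 : ∀ c : ℂ, Multipliable fun n : ℕ => 1 - p ^ (2 * n + 1) * c := by
    intro c
    have hs : Summable fun n : ℕ => ‖-(p ^ (2 * n + 1) * c)‖ := by
      refine ((summable_geometric_of_lt_one (norm_nonneg _) hQ).mul_right (‖p‖ * ‖c‖)).congr ?_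
      intro n
      simp only [norm_neg, norm_pow, norm_mul]
      ring
    simpa only [sub_eq_add_neg] using multipliable_one_add_of_summable hs
  have hm := (hm1.mul (hm2 w)).mul (hm2 w⁻¹)
  exact ⟨hm, tendsto_nhds_unique (jtp_tendsto hp hw hQ hsum) hm.tendsto_prod_tprod_nat⟩

end
end
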